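/- (Second Cartan structure equation.) Let γ be a connection field on U. For a smooth vector field c define ρ_{μν}(c) := ∇_{e_μ}⁺(∇_{e_ν}⁺c) − ∇_{e_ν}⁺(∇_{e_μ}⁺c) (the e_μ regarded as constant vector fields, whose Lie brackets vanish), the Cartan curvature field Ω(c,d)(p) := ½ Σ_{μ,ν=1}^n ⟨ρ_{μν}(c)(p), d(p)⟩ ι(e_μ)∧ι(e_ν) ∈ ⋀E, the Cartan connection operator of the first kind γ⁺(c,d) := Σ_{ν=1}^n ⟨∇_{e_ν}⁺c, d⟩ e_ν (an E-valued field), and γ⁻(u,d)(p) := Σ_{ν=1}^n ⟨u, (∇_{e_ν}⁻d)(p)⟩ e_ν. Then for all smooth vector fields c, d and every p ∈ U: Ω(c,d)(p) = Σ_{μ=1}^n ι(e_μ)∧ι( D(γ⁺(c,d))(p)(e_μ) ) + Σ_{μ=1}^n ι(γ⁺(c, e_μ)(p)) ∧ ι(γ⁻(e_μ, d)(p)), where in γ⁺(c, e_μ) the e_μ is the constant vector field. -/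

import Mathlib

open scoped RealInnerProductSpace

noncomputable section

/-- The model space `ℝⁿ` with its standard inner product. -/
abbrev E (n : ℕ) := EuclideanSpace ℝ (Fin n)

/-- The directional ordinary derivative `a·∂X` of a vector field. -/
def dD {n : ℕ} (a X : E n → E n) (p : E n) : E n := fderiv ℝ X p (a p)

/-- The plus covariant derivative `∇_a⁺X = a·∂X + γ_a(X)` associated to a connection field. -/
def covP {n : ℕ} (γ : E n → E n →L[ℝ] E n →L[ℝ] E n) (a X : E n → E n) (p : E n) : E n :=
  dD a X p + γ p (a p) (X p)

/-- The minus covariant derivative `∇_a⁻X = a·∂X − γ_a†(X)` associated to a connection field. -/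
def covM {n : ℕ} (γ : E n → E n →L[ℝ] E n →L[ℝ] E n) (a X : E n → E n) (p : E n) : E n :=
  dD a X p - ContinuousLinearMap.adjoint (γ p (a p)) (X p)

/-- The Lie bracket `[a,b] = a·∂b − b·∂a` of vector fields. -/
def lie {n : ℕ} (a b : E n → E n) (p : E n) : E n := dD a b p - dD b a p

/-- The standard orthonormal basis vectors of `ℝⁿ`. -/
def eb {n : ℕ} (μ : Fin n) : E n := EuclideanSpace.single μ (1 : ℝ)

/-- `ρ_{μν}(c) = ∇_{e_μ}⁺(∇_{e_ν}⁺c) − ∇_{e_ν}⁺(∇_{e_μ}⁺c)` for the constant frame fields. -/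
def rhoFrame {n : ℕ} (γ : E n → E n →L[ℝ] E n →L[ℝ] E n) (μ ν : Fin n) (c : E n → E n) :
    E n → E n :=
  fun p => covP γ (fun _ => eb μ) (covP γ (fun _ => eb ν) c) p
    - covP γ (fun _ => eb ν) (covP γ (fun _ => eb μ) c) p

/-- The Cartan curvature field `Ω(c,d)(p) = ½ Σ_{μ,ν} ⟨ρ_{μν}(c)(p), d(p)⟩ ι(e_μ)∧ι(e_ν)`. -/
def cartanCurv {n : ℕ} (γ : E n → E n →L[ℝ] E n →L[ℝ] E n) (c d : E n → E n) (p : E n) :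
    ExteriorAlgebra ℝ (E n) :=
  (1 / 2 : ℝ) • ∑ μ : Fin n, ∑ ν : Fin n,
    ⟪rhoFrame γ μ ν c p, d p⟫ • (ExteriorAlgebra.ι ℝ (eb μ) * ExteriorAlgebra.ι ℝ (eb ν))

/-- The Cartan connection operator of the first kind `γ⁺(c,d) = Σ_ν ⟨∇_{e_ν}⁺c, d⟩ e_ν`. -/
def cartanPlus {n : ℕ} (γ : E n → E n →L[ℝ] E n →L[ℝ] E n) (c d : E n → E n) :
    E n → E n :=
  fun p => ∑ ν : Fin n, ⟪covP γ (fun _ => eb ν) c p, d p⟫ • eb ν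

/-- The Cartan connection operator of the second kind
`γ⁻(u, d)(p) = Σ_ν ⟨u, (∇_{e_ν}⁻d)(p)⟩ e_ν`. -/
def cartanMinus {n : ℕ} (γ : E n → E n →L[ℝ] E n →L[ℝ] E n) (u : E n) (d : E n → E n)
    (p : E n) : E n :=
  ∑ ν : Fin n, ⟪u, covM γ (fun _ => eb ν) d p⟫ • eb ν

theorem ExteriorAlgebra.ι_mul_ι_swap {R M : Type*} [CommRing R] [AddCommGroup M] [Module R M]
    (x y : M) :
    ExteriorAlgebra.ι R y * ExteriorAlgebra.ι R x
      = -(ExteriorAlgebra.ι R x * ExteriorAlgebra.ι R y) :=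
  eq_neg_of_add_eq_zero_left (ExteriorAlgebra.ι_add_mul_swap y x)

/-- The coefficients of a 2-vector may be replaced by their negated transpose. -/
theorem sum_smul_ι_mul_ι_swap {R M ι' : Type*} [CommRing R] [AddCommGroup M] [Module R M]
    [Fintype ι'] (f : ι' → ι' → R) (e : ι' → M) :
    ∑ i, ∑ j, f i j • (ExteriorAlgebra.ι R (e i) * ExteriorAlgebra.ι R (e j))
      = ∑ i, ∑ j, (-f j i) • (ExteriorAlgebra.ι R (e i) * ExteriorAlgebra.ι R (e j)) := by
  rw [Finset.sum_comm]
  refine Finset.sum_congr rfl fun i _ => Finset.sum_congr rfl fun j _ => ?_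
  rw [ExteriorAlgebra.ι_mul_ι_swap (e i) (e j), smul_neg, neg_smul]

theorem half_smul_sum_sub_smul_ι_mul_ι {M ι' : Type*} [AddCommGroup M] [Module ℝ M]
    [Fintype ι'] (f : ι' → ι' → ℝ) (e : ι' → M) :
    (1 / 2 : ℝ) • ∑ i, ∑ j,
        (f i j - f j i) • (ExteriorAlgebra.ι ℝ (e i) * ExteriorAlgebra.ι ℝ (e j))
      = ∑ i, ∑ j, f i j • (ExteriorAlgebra.ι ℝ (e i) * ExteriorAlgebra.ι ℝ (e j)) := by
  simp only [sub_eq_add_neg, add_smul, Finset.sum_add_distrib]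
  rw [← sum_smul_ι_mul_ι_swap f e, ← two_smul ℝ, smul_smul]
  norm_num

theorem differentiableAt_covP_const {n : ℕ} {U : Set (E n)} (hU : IsOpen U)
    {γ : E n → E n →L[ℝ] E n →L[ℝ] E n} (hγ : ContDiffOn ℝ (⊤ : ℕ∞) γ U)
    {c : E n → E n} (hc : ContDiffOn ℝ (⊤ : ℕ∞) c U) (a : E n) {p : E n} (hp : p ∈ U) :
    DifferentiableAt ℝ (covP γ (fun _ => a) c) p := by
  have hc' := hc.contDiffAt (hU.mem_nhds hp)
  have h1 : DifferentiableAt ℝ (fderiv ℝ c) p :=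
    (hc'.fderiv_right (m := 1) (WithTop.coe_le_coe.2 le_top)).differentiableAt (by simp)
  have h2 : DifferentiableAt ℝ c p := hc'.differentiableAt (by simp)
  have h3 : DifferentiableAt ℝ γ p :=
    (hγ.contDiffAt (hU.mem_nhds hp)).differentiableAt (by simp)
  unfold covP dD
  exact (h1.clm_apply (differentiableAt_const a)).add
    ((h3.clm_apply (differentiableAt_const a)).clm_apply h2)

theorem fderiv_cartanPlus {n : ℕ} {γ : E n → E n →L[ℝ] E n →L[ℝ] E n} {c d : E n → E n}
    {p : E n} (hw : ∀ ν : Fin n, DifferentiableAt ℝ (covP γ (fun _ => eb ν) c) p)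
    (hd : DifferentiableAt ℝ d p) (a : E n) :
    fderiv ℝ (cartanPlus γ c d) p a = ∑ ν : Fin n,
      (⟪covP γ (fun _ => eb ν) c p, fderiv ℝ d p a⟫
        + ⟪fderiv ℝ (covP γ (fun _ => eb ν) c) p a, d p⟫) • eb ν := by
  unfold cartanPlus
  rw [fderiv_fun_sum fun ν _ => ((hw ν).inner ℝ hd).smul_const _, _root_.sum_apply]
  refine Finset.sum_congr rfl fun ν _ => ?_
  rw [fderiv_smul_const ((hw ν).inner ℝ hd), ContinuousLinearMap.smulRight_apply,
    fderiv_inner_apply ℝ (hw ν) hd]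

theorem sum_inner_eb_mul_inner_eb {n : ℕ} (x y : E n) :
    ∑ μ : Fin n, ⟪x, eb μ⟫ * ⟪eb μ, y⟫ = ⟪x, y⟫ := by
  simpa [eb] using (EuclideanSpace.basisFun (Fin n) ℝ).sum_inner_mul_inner x y

/-- The wedge of the two Cartan connection operators, contracted over the frame. -/
theorem sum_cartanPlus_mul_cartanMinus {n : ℕ} (γ : E n → E n →L[ℝ] E n →L[ℝ] E n)
    (c d : E n → E n) (p : E n) :
    ∑ μ : Fin n, ExteriorAlgebra.ι ℝ (cartanPlus γ c (fun _ => eb μ) p)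
        * ExteriorAlgebra.ι ℝ (cartanMinus γ (eb μ) d p)
      = ∑ α : Fin n, ∑ β : Fin n,
        ⟪covP γ (fun _ => eb α) c p, covM γ (fun _ => eb β) d p⟫
          • (ExteriorAlgebra.ι ℝ (eb α) * ExteriorAlgebra.ι ℝ (eb β)) := by
  simp only [cartanPlus, cartanMinus, map_sum, map_smul, Finset.sum_mul_sum, smul_mul_smul_comm]
  rw [Finset.sum_comm]
  refine Finset.sum_congr rfl fun α _ => ?_
  rw [Finset.sum_comm]
  refine Finset.sum_congr rfl fun β _ => ?_
  rw [← Finset.sum_smul, sum_inner_eb_mul_inner_eb]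

/-- **Second Cartan structure equation.**
`Ω(c,d) = ∂∧γ⁺(c,d) + γ⁺(c,∂_s)∧γ⁻(s,d)` expressed in the standard orthonormal frame. -/
theorem stmt_18 {n : ℕ} (hn : 1 ≤ n) (U : Set (E n)) (hU : IsOpen U)
    (γ : E n → E n →L[ℝ] E n →L[ℝ] E n) (hγ : ContDiffOn ℝ (⊤ : ℕ∞) γ U) :
    ∀ c d : E n → E n, ContDiffOn ℝ (⊤ : ℕ∞) c U → ContDiffOn ℝ (⊤ : ℕ∞) d U → ∀ p ∈ U,
      cartanCurv γ c d p
        = (∑ μ : Fin n, ExteriorAlgebra.ι ℝ (eb μ)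
            * ExteriorAlgebra.ι ℝ (fderiv ℝ (cartanPlus γ c d) p (eb μ)))
          + ∑ μ : Fin n, ExteriorAlgebra.ι ℝ (cartanPlus γ c (fun _ => eb μ) p)
            * ExteriorAlgebra.ι ℝ (cartanMinus γ (eb μ) d p) := by
  intro c d hc hd p hp
  have hw := fun ν : Fin n => differentiableAt_covP_const hU hγ hc (eb ν) hp
  have hd' : DifferentiableAt ℝ d p := (hd.contDiffAt (hU.mem_nhds hp)).differentiableAt (by simp)
  rw [sum_cartanPlus_mul_cartanMinus, sum_smul_ι_mul_ι_swap]
  simp only [cartanCurv, rhoFrame, inner_sub_left]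
  rw [half_smul_sum_sub_smul_ι_mul_ι fun μ ν =>
    ⟪covP γ (fun _ => eb μ) (covP γ (fun _ => eb ν) c) p, d p⟫, ← Finset.sum_add_distrib]
  refine Finset.sum_congr rfl fun μ _ => ?_
  rw [fderiv_cartanPlus hw hd', map_sum, Finset.mul_sum, ← Finset.sum_add_distrib]
  refine Finset.sum_congr rfl fun ν _ => ?_
  rw [map_smul, mul_smul_comm, ← add_smul]
  congr 1
  rw [covP, covM, inner_add_left, inner_sub_right, ContinuousLinearMap.adjoint_inner_right, dD, dD]
  ring
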